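/- arXiv:1606.02766 — 2 statements merged into one kernel-verified Lean document; each statement's English description precedes it below -/
import Mathlib

section
/- Let c, δ be reals with δ > 0, −1 ≤ c−2δ, and c+2δ ≤ 1, and let f₁ be the hump function defined below on [−1,1]. Then f₁ is twice differentiable at every point of (−1,1) except possibly at the four points c−2δ, c−δ, c+δ, c+2δ; at all other points of (−1,1) its second derivative equals f₁''(x) = δ^{−2}·(1 + sign(x−c−δ) − sign(x−c+δ)) when |x−c| < 2δ and f₁''(x) = 0 when |x−c| > 2δ; and consequently ‖f₁''‖_{1/2,[−1,1]} = (∫_{−1}^{1} √|f₁''(x)| dx)² = 16. -/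
open Set MeasureTheory

/-- The hump function `f₁` on `[−1,1]` with parameters `c` and `δ`. -/
noncomputable def hump (c δ : ℝ) (x : ℝ) : ℝ :=
  if |x - c| ≤ 2 * δ then
    (1 / (2 * δ ^ 2)) *
      (4 * δ ^ 2 + (x - c) ^ 2 + (x - c - δ) * |x - c - δ| - (x - c + δ) * |x - c + δ|)
  else 0

/-- The second derivative of `f₁` away from the four kink points. -/
noncomputable def humpD2 (c δ : ℝ) (x : ℝ) : ℝ :=
  if |x - c| < 2 * δ then
    (1 / δ ^ 2) * (1 + Real.sign (x - c - δ) - Real.sign (x - c + δ))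
  else 0

lemma hasDerivAt_mul_abs_self (x : ℝ) : HasDerivAt (fun t : ℝ => t * |t|) (2 * |x|) x := by
  rcases eq_or_ne x 0 with rfl | hx
  · rw [hasDerivAt_iff_tendsto_slope_zero]
    have h : Filter.Tendsto (fun t : ℝ => |t|) (nhdsWithin 0 {0}ᶜ) (nhds (2 * |(0 : ℝ)|)) := by
      have h0 : ContinuousAt (fun t : ℝ => |t|) 0 := continuous_abs.continuousAt
      simpa [ContinuousAt] using h0.tendsto.mono_left nhdsWithin_le_nhds
    refine h.congr' ?_
    filter_upwards [self_mem_nhdsWithin] with t ht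
    have ht : t ≠ 0 := ht
    simp [ht]
  · refine ((hasDerivAt_id x).mul (hasDerivAt_abs hx)).congr_deriv ?_
    simp only [id, one_mul, self_mul_sign]
    ring

/-- The hump function as a combination of shifts of `t ↦ t * |t|`. -/
lemma hump_eq {δ : ℝ} (hδ : 0 < δ) (c x : ℝ) :
    hump c δ x = (1 / (2 * δ ^ 2)) *
      ((x - (c + δ)) * |x - (c + δ)| - (x - (c - δ)) * |x - (c - δ)|
        - (1 / 2) * ((x - (c + 2 * δ)) * |x - (c + 2 * δ)|)
        + (1 / 2) * ((x - (c - 2 * δ)) * |x - (c - 2 * δ)|)) := by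
  have h₁ : x - c - δ = x - (c + δ) := by ring
  have h₂ : x - c + δ = x - (c - δ) := by ring
  unfold hump
  rw [h₁, h₂]
  split_ifs with h
  · rw [abs_le] at h
    rw [abs_of_nonpos (by linarith : x - (c + 2 * δ) ≤ 0),
      abs_of_nonneg (by linarith : 0 ≤ x - (c - 2 * δ))]
    ring
  · rw [not_le, lt_abs] at h
    rcases h with h | h
    · rw [abs_of_nonneg (by linarith : 0 ≤ x - (c + 2 * δ)),
        abs_of_nonneg (by linarith : 0 ≤ x - (c - 2 * δ)),
        abs_of_nonneg (by linarith : 0 ≤ x - (c + δ)),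
        abs_of_nonneg (by linarith : 0 ≤ x - (c - δ))]
      ring
    · rw [abs_of_nonpos (by linarith : x - (c + 2 * δ) ≤ 0),
        abs_of_nonpos (by linarith : x - (c - 2 * δ) ≤ 0),
        abs_of_nonpos (by linarith : x - (c + δ) ≤ 0),
        abs_of_nonpos (by linarith : x - (c - δ) ≤ 0)]
      ring

/-- The first derivative of the hump function. -/
noncomputable def humpD1 (c δ : ℝ) (x : ℝ) : ℝ :=
  (1 / δ ^ 2) * (|x - (c + δ)| - |x - (c - δ)|
    - (1 / 2) * |x - (c + 2 * δ)| + (1 / 2) * |x - (c - 2 * δ)|)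

lemma hasDerivAt_hump {δ : ℝ} (hδ : 0 < δ) (c x : ℝ) :
    HasDerivAt (hump c δ) (humpD1 c δ x) x := by
  have h (a : ℝ) : HasDerivAt (fun t : ℝ => (t - a) * |t - a|) (2 * |x - a|) x :=
    (hasDerivAt_mul_abs_self (x - a)).comp_sub_const x a
  rw [funext (hump_eq hδ c)]
  refine (((((h (c + δ)).sub (h (c - δ))).sub ((h (c + 2 * δ)).const_mul (1 / 2))).add
    ((h (c - 2 * δ)).const_mul (1 / 2))).const_mul (1 / (2 * δ ^ 2))).congr_deriv ?_
  unfold humpD1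
  field_simp

lemma hasDerivAt_abs_sub {a x : ℝ} (hx : x ≠ a) :
    HasDerivAt (fun t : ℝ => |t - a|) (Real.sign (x - a)) x := by
  have h := (hasDerivAt_abs (sub_ne_zero.2 hx)).comp_sub_const x a
  rcases hx.lt_or_gt with h' | h'
  · rw [Real.sign_of_neg (sub_neg.2 h')]
    simpa [sign_neg (sub_neg.2 h')] using h
  · rw [Real.sign_of_pos (sub_pos.2 h')]
    simpa [sign_pos (sub_pos.2 h')] using h

lemma hasDerivAt_humpD1 {c δ x : ℝ} (hδ : 0 < δ)
    (hx : x ∉ ({c - 2 * δ, c - δ, c + δ, c + 2 * δ} : Set ℝ)) :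
    HasDerivAt (humpD1 c δ) (humpD2 c δ x) x := by
  simp only [mem_insert_iff, mem_singleton_iff, not_or] at hx
  obtain ⟨h₁, h₂, h₃, h₄⟩ := hx
  refine (((((hasDerivAt_abs_sub h₃).sub (hasDerivAt_abs_sub h₂)).sub
    ((hasDerivAt_abs_sub h₄).const_mul (1 / 2))).add
    ((hasDerivAt_abs_sub h₁).const_mul (1 / 2))).const_mul (1 / δ ^ 2)).congr_deriv ?_
  have e₁ : x - c - δ = x - (c + δ) := by ring
  have e₂ : x - c + δ = x - (c - δ) := by ring
  unfold humpD2
  rw [e₁, e₂]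
  split_ifs with h
  · rw [abs_lt] at h
    rw [Real.sign_of_neg (by linarith : x - (c + 2 * δ) < 0),
      Real.sign_of_pos (by linarith : 0 < x - (c - 2 * δ))]
    ring
  · rw [not_lt, le_abs] at h
    rcases h with h | h
    · have h' : c + 2 * δ < x := lt_of_le_of_ne (by linarith) (Ne.symm h₄)
      rw [Real.sign_of_pos (by linarith : 0 < x - (c + 2 * δ)),
        Real.sign_of_pos (by linarith : 0 < x - (c - 2 * δ)),
        Real.sign_of_pos (by linarith : 0 < x - (c + δ)),
        Real.sign_of_pos (by linarith : 0 < x - (c - δ))]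
      ring
    · have h' : x < c - 2 * δ := lt_of_le_of_ne (by linarith) h₁
      rw [Real.sign_of_neg (by linarith : x - (c + 2 * δ) < 0),
        Real.sign_of_neg (by linarith : x - (c - 2 * δ) < 0),
        Real.sign_of_neg (by linarith : x - (c + δ) < 0),
        Real.sign_of_neg (by linarith : x - (c - δ) < 0)]
      ring

lemma sqrt_abs_humpD2 {c δ x : ℝ} (hδ : 0 < δ) (h₁ : x ≠ c - δ) (h₂ : x ≠ c + δ) :
    √|humpD2 c δ x| = (Ioo (c - 2 * δ) (c + 2 * δ)).indicator (fun _ => 1 / δ) x := by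
  have hiff : |x - c| < 2 * δ ↔ x ∈ Ioo (c - 2 * δ) (c + 2 * δ) := by
    rw [abs_lt, mem_Ioo]
    constructor <;> rintro ⟨_, _⟩ <;> constructor <;> linarith
  unfold humpD2
  by_cases h : x ∈ Ioo (c - 2 * δ) (c + 2 * δ)
  · rw [if_pos (hiff.2 h), indicator_of_mem h]
    have hs : |1 + Real.sign (x - c - δ) - Real.sign (x - c + δ)| = 1 := by
      rcases h₁.lt_or_gt with h₁ | h₁
      · rw [Real.sign_of_neg (by linarith : x - c - δ < 0),
          Real.sign_of_neg (by linarith : x - c + δ < 0)]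
        norm_num
      · rw [Real.sign_of_pos (by linarith : 0 < x - c + δ)]
        rcases h₂.lt_or_gt with h₂ | h₂
        · rw [Real.sign_of_neg (by linarith : x - c - δ < 0)]
          norm_num
        · rw [Real.sign_of_pos (by linarith : 0 < x - c - δ)]
          norm_num
    rw [abs_mul, hs, mul_one, abs_of_pos (by positivity), ← one_div_pow,
      Real.sqrt_sq (by positivity)]
  · rw [if_neg (mt hiff.1 h), indicator_of_notMem h]
    simp

lemma integral_sqrt_abs_humpD2 {c δ : ℝ} (hδ : 0 < δ) (hl : -1 ≤ c - 2 * δ)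
    (hr : c + 2 * δ ≤ 1) : ∫ x in (-1 : ℝ)..1, √|humpD2 c δ x| = 4 := by
  have hae : ∀ᵐ x : ℝ, x ∈ uIoc (-1 : ℝ) 1 → √|humpD2 c δ x| =
      (Ioo (c - 2 * δ) (c + 2 * δ)).indicator (fun _ => 1 / δ) x := by
    filter_upwards [Measure.ae_ne volume (c - δ), Measure.ae_ne volume (c + δ)] with x h₁ h₂ _
    exact sqrt_abs_humpD2 hδ h₁ h₂
  have hsub : Ioo (c - 2 * δ) (c + 2 * δ) ⊆ Ioc (-1) 1 := fun x hx =>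
    ⟨hl.trans_lt hx.1, hx.2.le.trans hr⟩
  rw [intervalIntegral.integral_congr_ae hae, intervalIntegral.integral_of_le (by norm_num),
    setIntegral_indicator measurableSet_Ioo, inter_eq_right.2 hsub, setIntegral_const,
    Real.volume_real_Ioo_of_le (by linarith), smul_eq_mul]
  field_simp
  ring

/-- `f₁` is twice differentiable on `(−1,1)` except possibly at
`c−2δ, c−δ, c+δ, c+2δ`, with second derivative `humpD2`, and
`‖f₁''‖_{1/2,[−1,1]} = (∫_{−1}^1 √|f₁''|)² = 16`. -/
theorem stmt9 (c δ : ℝ) (hδ : 0 < δ) (hl : -1 ≤ c - 2 * δ) (hr : c + 2 * δ ≤ 1) :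
    (∃ f' : ℝ → ℝ,
      (∀ x ∈ Set.Icc (-1 : ℝ) 1, HasDerivWithinAt (hump c δ) (f' x) (Set.Icc (-1 : ℝ) 1) x) ∧
      (∀ x ∈ Set.Ioo (-1 : ℝ) 1,
        x ∉ ({c - 2 * δ, c - δ, c + δ, c + 2 * δ} : Set ℝ) →
        HasDerivAt f' (humpD2 c δ x) x)) ∧
    (∫ x in (-1 : ℝ)..1, Real.sqrt |humpD2 c δ x|) ^ 2 = 16 := by
  refine ⟨⟨humpD1 c δ, fun x _ => (hasDerivAt_hump hδ c x).hasDerivWithinAt,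
    fun x _ hx => hasDerivAt_humpD1 hδ hx⟩, ?_⟩
  rw [integral_sqrt_abs_humpD2 hδ hl hr]
  norm_num
end

section
/- (Fooling-function lemma underlying the lower complexity bound on the ball of W^{2,∞}.) Let a < b, σ > 0, n ∈ ℕ, and let x₁, …, xₙ be any points in [a,b]. Then there exists a function g : ℝ → ℝ that is differentiable on [a,b] with ‖g''‖_{[a,b]} ≤ σ, such that g(xᵢ) = 0 for all i = 1,…,n and sup_{x∈[a,b]} |g(x)| ≥ σ(b−a)²/(16(n+1)²). -/
open Set MeasureTheory

/-- `‖f''‖_{[α,β]} := sup_{α ≤ η < ζ ≤ β} |f'(ζ) − f'(η)|/(ζ − η)`,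
defined via the derivative `f'`. -/
noncomputable def nSup (f' : ℝ → ℝ) (α β : ℝ) : ℝ :=
  sSup {q : ℝ | ∃ η ζ, α ≤ η ∧ η < ζ ∧ ζ ≤ β ∧ q = |f' ζ - f' η| / (ζ - η)}

/-- `‖f''‖_{−∞,[α,β]} := inf_{α ≤ η < ζ ≤ β} |f'(ζ) − f'(η)|/(ζ − η)`,
defined via the derivative `f'`. -/
noncomputable def nInf (f' : ℝ → ℝ) (α β : ℝ) : ℝ :=
  sInf {q : ℝ | ∃ η ζ, α ≤ η ∧ η < ζ ∧ ζ ≤ β ∧ q = |f' ζ - f' η| / (ζ - η)}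

theorem hasDerivAt_max_zero_sq (t : ℝ) :
    HasDerivAt (fun s : ℝ => max s 0 ^ 2) (2 * max t 0) t := by
  rcases lt_trichotomy t 0 with h | rfl | h
  · rw [max_eq_right h.le, mul_zero]
    refine (hasDerivAt_const t (0 : ℝ)).congr_of_eventuallyEq ?_
    filter_upwards [Iio_mem_nhds h] with s hs
    rw [max_eq_right (le_of_lt hs)]
    norm_num
  · rw [max_self, mul_zero]
    refine hasDerivAt_iff_isLittleO_nhds_zero.2 ?_
    refine Asymptotics.IsBigO.trans_isLittleO (g := fun s : ℝ => s ^ 2) ?_ ?_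
    · refine Asymptotics.isBigO_of_le _ fun s => ?_
      simp only [zero_add, max_self, smul_zero, sub_zero, norm_pow, Real.norm_eq_abs]
      norm_num
      rcases le_total s 0 with hs | hs
      · simpa [max_eq_right hs] using sq_nonneg s
      · rw [max_eq_left hs]
    · exact Asymptotics.isLittleO_pow_id one_lt_two
  · rw [max_eq_left h.le]
    have := hasDerivAt_pow 2 t
    norm_num at this
    refine this.congr_of_eventuallyEq ?_
    filter_upwards [Ioi_mem_nhds h] with s hs
    rw [max_eq_left (le_of_lt hs)]

/-- The quadratic spline bump with support `[p, p + 4 * r]`, peak at `p + 2 * r`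
and second derivative `±σ`. -/
noncomputable def splineBump (σ p r t : ℝ) : ℝ :=
  σ / 2 * (max (t - p) 0 ^ 2 - 2 * max (t - (p + r)) 0 ^ 2
    + 2 * max (t - (p + 3 * r)) 0 ^ 2 - max (t - (p + 4 * r)) 0 ^ 2)

/-- The derivative of `splineBump`. -/
noncomputable def splineBumpDeriv (σ p r t : ℝ) : ℝ :=
  σ * (max (t - p) 0 - 2 * max (t - (p + r)) 0
    + 2 * max (t - (p + 3 * r)) 0 - max (t - (p + 4 * r)) 0)

theorem hasDerivAt_splineBump (σ p r t : ℝ) :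
    HasDerivAt (splineBump σ p r) (splineBumpDeriv σ p r t) t := by
  have h (c : ℝ) : HasDerivAt (fun s : ℝ => max (s - c) 0 ^ 2) (2 * max (t - c) 0) t :=
    (hasDerivAt_max_zero_sq (t - c)).comp_sub_const t c
  have H := ((((h p).sub ((h (p + r)).const_mul 2)).add
    ((h (p + 3 * r)).const_mul 2)).sub (h (p + 4 * r))).const_mul (σ / 2)
  refine H.congr_deriv ?_
  unfold splineBumpDeriv
  ring

theorem max_sub_zero_increment_anti {c d η ζ : ℝ} (hcd : c ≤ d) (h : η ≤ ζ) :
    max (ζ - d) 0 - max (η - d) 0 ≤ max (ζ - c) 0 - max (η - c) 0 := by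
  grind

theorem abs_splineBumpDeriv_sub_le {σ r : ℝ} (hσ : 0 ≤ σ) (hr : 0 ≤ r) (p : ℝ) {η ζ : ℝ}
    (h : η ≤ ζ) :
    |splineBumpDeriv σ p r ζ - splineBumpDeriv σ p r η| ≤ σ * (ζ - η) := by
  have h₁ := max_sub_zero_increment_anti (c := p) (d := p + r) (by linarith) h
  have h₂ := max_sub_zero_increment_anti (c := p + r) (d := p + 3 * r) (by linarith) h
  have h₃ := max_sub_zero_increment_anti (c := p + 3 * r) (d := p + 4 * r) (by linarith) h
  have h₀ : max (ζ - p) 0 - max (η - p) 0 ≤ ζ - η := by grind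
  have h₄ : 0 ≤ max (ζ - (p + 4 * r)) 0 - max (η - (p + 4 * r)) 0 := by grind
  unfold splineBumpDeriv
  rw [← mul_sub, abs_mul, abs_of_nonneg hσ]
  refine mul_le_mul_of_nonneg_left ?_ hσ
  rw [abs_le]
  constructor <;> linarith

theorem splineBump_eq_zero_of_le (σ : ℝ) {p r t : ℝ} (hr : 0 ≤ r) (ht : t ≤ p) :
    splineBump σ p r t = 0 := by
  unfold splineBump
  rw [max_eq_right (by linarith), max_eq_right (by linarith), max_eq_right (by linarith),
    max_eq_right (by linarith)]
  ring

theorem splineBump_eq_zero_of_ge (σ : ℝ) {p r t : ℝ} (hr : 0 ≤ r) (ht : p + 4 * r ≤ t) :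
    splineBump σ p r t = 0 := by
  unfold splineBump
  rw [max_eq_left (by linarith), max_eq_left (by linarith), max_eq_left (by linarith),
    max_eq_left (by linarith)]
  ring

theorem splineBump_peak (σ p : ℝ) {r : ℝ} (hr : 0 ≤ r) :
    splineBump σ p r (p + 2 * r) = σ * r ^ 2 := by
  unfold splineBump
  rw [max_eq_left (by linarith), max_eq_left (by linarith), max_eq_right (by linarith),
    max_eq_right (by linarith)]
  ring

/-- Among `n + 1` consecutive open intervals of equal length, one contains none of `n` given
points. -/
theorem exists_gap (a : ℝ) {h : ℝ} (hh : 0 < h) {n : ℕ} (x : Fin n → ℝ) :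
    ∃ k : Fin (n + 1), ∀ i, x i ≤ a + k * h ∨ a + k * h + h ≤ x i := by
  by_contra! H
  choose f hf using H
  have hinj : Function.Injective f := by
    have aux (k l : Fin (n + 1)) (e : f k = f l) : (k : ℕ) ≤ l := by
      have h₁ := (hf k).1
      have h₂ := (hf l).2
      rw [e] at h₁
      have : (k : ℝ) < l + 1 := by
        refine lt_of_mul_lt_mul_right ?_ hh.le
        linarith
      exact Nat.lt_succ_iff.1 (by exact_mod_cast this)
    exact fun k l e => Fin.ext (le_antisymm (aux k l e) (aux l k e.symm))
  simpa using Fintype.card_le_of_injective f hinj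

/-- Fooling-function lemma for the ball of `W^{2,∞}`: given any `n` data sites
in `[a,b]` and any `σ > 0`, there is `g` differentiable on `[a,b]` with
`‖g''‖_{[a,b]} ≤ σ`, vanishing at all data sites, and with
`sup_{[a,b]} |g| ≥ σ(b−a)²/(16(n+1)²)`. -/
theorem stmt13 (a b σ : ℝ) (hab : a < b) (hσ : 0 < σ)
    (n : ℕ) (x : Fin n → ℝ) (hx : ∀ i, x i ∈ Set.Icc a b) :
    ∃ g g' : ℝ → ℝ,
      (∀ t ∈ Set.Icc a b, HasDerivWithinAt g (g' t) (Set.Icc a b) t) ∧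
      nSup g' a b ≤ σ ∧
      (∀ i, g (x i) = 0) ∧
      ∃ t ∈ Set.Icc a b, σ * (b - a) ^ 2 / (16 * ((n : ℝ) + 1) ^ 2) ≤ |g t| := by
  have hn : (0 : ℝ) < n + 1 := by positivity
  obtain ⟨r, hr⟩ : ∃ r, r = (b - a) / (4 * ((n : ℝ) + 1)) := ⟨_, rfl⟩
  have hr0 : 0 < r := hr ▸ div_pos (sub_pos.2 hab) (by positivity)
  have hb : b = a + (n + 1) * (4 * r) := by
    rw [hr]
    field_simp
    ring
  obtain ⟨k, hk⟩ := exists_gap a (h := 4 * r) (by positivity) x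
  have hkn : (k : ℝ) ≤ n := by exact_mod_cast Nat.lt_succ_iff.1 k.2
  have hkr : (k : ℝ) * r ≤ n * r := mul_le_mul_of_nonneg_right hkn hr0.le
  have hk0 : 0 ≤ (k : ℝ) * r := by positivity
  set p := a + k * (4 * r) with hp
  refine ⟨splineBump σ p r, splineBumpDeriv σ p r,
    fun t _ => (hasDerivAt_splineBump σ p r t).hasDerivWithinAt, ?_, fun i => ?_,
    p + 2 * r, ⟨by linarith, by linarith⟩, ?_⟩
  · refine Real.sSup_le ?_ hσ.le
    rintro q ⟨η, ζ, -, h, -, rfl⟩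
    rw [div_le_iff₀ (sub_pos.2 h)]
    exact abs_splineBumpDeriv_sub_le hσ.le hr0.le p h.le
  · rcases hk i with h | h
    · exact splineBump_eq_zero_of_le σ hr0.le h
    · exact splineBump_eq_zero_of_ge σ hr0.le h
  · rw [splineBump_peak σ p hr0.le, abs_of_nonneg (by positivity), hr]
    apply le_of_eq
    field_simp
    ring
end
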